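/- (Geometric Lemma 2.1, parts 1 and 3: the first nonresonance set has asymptotically full measure.) There exist C > 0 and k₀ > 0, depending only on l, δ, b₁, b₂, such that for every k > k₀ the resonant angle set Θ_res = {θ ∈ [0,2π) : there exists m ∈ ℤ²∖{0} with | |k·(cos θ, sin θ) + p_m(0)|² − k² | ≤ 2·k^{−4s₁−δ}} has Lebesgue measure at most C·k^{−δ/2}. In particular, the set of points x on the circle |x| = k satisfying | |x + p_m(0)|² − k² | > 2·k^{−4s₁−δ} for all m ∈ ℤ²∖{0} has one-dimensional measure at least 2πk·(1 − C·k^{−δ/2}). -/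

import Mathlib

open Real Set MeasureTheory

noncomputable section

/-- `s₁ = (2l-11)/32`. -/
def s1 (l : ℕ) : ℝ := (2 * (l : ℝ) - 11) / 32

/-- The dual-lattice point `p_m(0) = (2πm₁/a₁, 2πm₂/a₂)` in the Euclidean plane. -/
def pvecE (a₁ a₂ : ℝ) (m : ℤ × ℤ) : EuclideanSpace ℝ (Fin 2) :=
  (WithLp.equiv 2 (Fin 2 → ℝ)).symm ![2 * π * m.1 / a₁, 2 * π * m.2 / a₂]

/-- The point `k(cos θ, sin θ)` of the circle of radius `k`. -/
def circpt (k θ : ℝ) : EuclideanSpace ℝ (Fin 2) :=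
  (WithLp.equiv 2 (Fin 2 → ℝ)).symm ![k * Real.cos θ, k * Real.sin θ]

lemma sin_half_ge {D : ℝ} (h : |D| ≤ π) : |D| / π ≤ |Real.sin (D / 2)| := by
  have h1 : |D / 2| = |D| / 2 := by rw [abs_div]; norm_num
  have h2 : Real.sin |D / 2| ≤ |Real.sin (D/2)| := by
    rcases abs_cases (D/2) with h | h
    · rw [h.1]; exact le_abs_self _
    · rw [h.1, Real.sin_neg]; exact neg_le_abs _
  have h3 := Real.mul_le_sin (x := |D / 2|) (abs_nonneg _) (by rw [h1]; linarith)
  rw [h1] at h3 h2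
  have : 2 / π * (|D| / 2) = |D| / π := by field_simp
  linarith

lemma cos_diff_ge {a b : ℝ} (ha : a ∈ Icc 0 π) (hb : b ∈ Icc 0 π) :
    (Real.sin a + Real.sin b) * (|a - b| / π) ≤ |Real.cos a - Real.cos b| := by
  have hab : |a - b| ≤ π := by
    rw [abs_le]; constructor <;> linarith [ha.1, ha.2, hb.1, hb.2]
  have h := sin_half_ge hab
  have h0 : 0 ≤ Real.sin ((a + b) / 2) := by
    apply Real.sin_nonneg_of_nonneg_of_le_pi <;> linarith [ha.1, ha.2, hb.1, hb.2]
  have h1 : Real.sin a + Real.sin b ≤ 2 * Real.sin ((a + b) / 2) := by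
    have e1 : a = (a + b) / 2 + (a - b) / 2 := by ring
    have e2 : b = (a + b) / 2 - (a - b) / 2 := by ring
    have : Real.sin a + Real.sin b = 2 * Real.sin ((a + b) / 2) * Real.cos ((a - b) / 2) := by
      conv_lhs => rw [e1]
      conv_lhs => rw [show Real.sin b = Real.sin ((a + b) / 2 - (a - b) / 2) by rw [← e2]]
      rw [Real.sin_add, Real.sin_sub]; ring
    rw [this]
    have := Real.cos_le_one ((a - b) / 2)
    nlinarith
  rw [Real.cos_sub_cos, abs_mul, abs_mul, abs_of_nonneg h0]
  have : |(-2 : ℝ)| = 2 := by norm_num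
  rw [this]
  have hp : 0 ≤ |a - b| / π := by positivity
  calc _ ≤ 2 * Real.sin ((a + b) / 2) * (|a - b| / π) := by gcongr
    _ ≤ _ := by gcongr

lemma cos_diff_ge' {a b : ℝ} (ha : a ∈ Icc 0 π) (hb : b ∈ Icc 0 π) :
    2 * (|a - b| / π) ^ 2 ≤ |Real.cos a - Real.cos b| := by
  have hab : |a - b| ≤ π := by
    rw [abs_le]; constructor <;> linarith [ha.1, ha.2, hb.1, hb.2]
  have h := sin_half_ge hab
  have h0 : |a - b| / π ≤ Real.sin ((a + b) / 2) := by
    by_cases hc : a + b ≤ π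
    · have h3 := Real.mul_le_sin (x := (a + b) / 2) (by linarith [ha.1, hb.1]) (by linarith)
      have : |a - b| ≤ a + b := by rw [abs_le]; constructor <;> linarith [ha.1, hb.1]
      have e : 2 / π * ((a + b) / 2) = (a + b) / π := by field_simp
      rw [e] at h3
      refine le_trans ?_ h3
      gcongr
    · push Not at hc
      have h3 := Real.mul_le_sin (x := π - (a + b) / 2) (by linarith [ha.2, hb.2]) (by linarith)
      rw [Real.sin_pi_sub] at h3
      have : |a - b| ≤ 2 * π - (a + b) := by rw [abs_le]; constructor <;> linarith [ha.2, hb.2]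
      have e : 2 / π * (π - (a + b) / 2) = (2 * π - (a + b)) / π := by field_simp
      rw [e] at h3
      refine le_trans ?_ h3
      gcongr
  have hp : 0 ≤ |a - b| / π := by positivity
  rw [Real.cos_sub_cos, abs_mul, abs_mul, abs_of_nonneg (hp.trans h0)]
  have : |(-2 : ℝ)| = 2 := by norm_num
  rw [this]
  have hs0 := hp.trans h0
  calc _ = 2 * (|a - b| / π) * (|a - b| / π) := by ring
    _ ≤ 2 * Real.sin ((a + b) / 2) * (|a - b| / π) := by gcongr
    _ ≤ _ := by gcongr

lemma arcA (c η : ℝ) : ∃ z, ∀ ψ ∈ Icc 0 π, |Real.cos ψ + c| ≤ η → |ψ - z| ≤ π * √η := by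
  by_cases h : ∃ z ∈ Icc 0 π, |Real.cos z + c| ≤ η
  · obtain ⟨z, hz, hz'⟩ := h
    refine ⟨z, fun ψ hψ h => ?_⟩
    have h1 := cos_diff_ge' hψ hz
    have h2 : |Real.cos ψ - Real.cos z| ≤ 2 * η := by
      rw [abs_le] at *; constructor <;> linarith [h.1, h.2, hz'.1, hz'.2]
    have h3 : |ψ - z| / π ≤ √η := Real.le_sqrt_of_sq_le (by linarith)
    rw [div_le_iff₀ Real.pi_pos] at h3
    linarith
  · push Not at h
    exact ⟨0, fun ψ hψ h' => absurd h' (not_le.mpr (h ψ hψ))⟩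

lemma arcB (c η : ℝ) (hc : c ^ 2 < 1) :
    ∃ z, ∀ ψ ∈ Icc 0 π, |Real.cos ψ + c| ≤ η → |ψ - z| ≤ π * (η / √(1 - c ^ 2)) := by
  refine ⟨Real.arccos (-c), fun ψ hψ h => ?_⟩
  have hc' := abs_le.mp ((abs_le_one_iff_mul_self_le_one).mpr (by nlinarith) : |c| ≤ 1)
  have h1 := cos_diff_ge hψ ⟨Real.arccos_nonneg (-c), Real.arccos_le_pi (-c)⟩
  rw [Real.cos_arccos (by linarith) (by linarith), Real.sin_arccos, sub_neg_eq_add] at h1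
  have hs := Real.sin_nonneg_of_nonneg_of_le_pi hψ.1 hψ.2
  have hpos : 0 < √(1 - c ^ 2) := Real.sqrt_pos.mpr (by linarith)
  rw [neg_sq] at h1
  have h2 : √(1 - c ^ 2) * (|ψ - Real.arccos (-c)| / π) ≤ η := by
    have : 0 ≤ |ψ - Real.arccos (-c)| / π := by positivity
    nlinarith
  have h3 : |ψ - Real.arccos (-c)| / π ≤ η / √(1 - c ^ 2) := by
    rw [le_div_iff₀ hpos]; linarith
  rw [div_le_iff₀ Real.pi_pos] at h3
  linarith

lemma arc_cover (c η φ z r : ℝ) (hφ : φ ∈ Icc (-π) π)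
    (h : ∀ ψ ∈ Icc 0 π, |Real.cos ψ + c| ≤ η → |ψ - z| ≤ r) :
    volume {θ : ℝ | θ ∈ Ico 0 (2 * π) ∧ |Real.cos (θ - φ) + c| ≤ η} ≤ ENNReal.ofReal (8 * r) := by
  have hsub : {θ : ℝ | θ ∈ Ico 0 (2 * π) ∧ |Real.cos (θ - φ) + c| ≤ η} ⊆
      (Metric.closedBall (φ + z) r ∪ Metric.closedBall (φ - z) r) ∪
      (Metric.closedBall (φ + 2 * π + z) r ∪ Metric.closedBall (φ + 2 * π - z) r) := by
    rintro θ ⟨h1, h2⟩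
    have key : ∀ ψ ∈ Icc (-π) π, |Real.cos ψ + c| ≤ η → |ψ - z| ≤ r ∨ |ψ + z| ≤ r := by
      intro ψ hψ hc
      have := h |ψ| ⟨abs_nonneg _, abs_le.mpr hψ⟩ (by rwa [Real.cos_abs])
      rcases abs_cases ψ with h | h
      · left; rwa [h.1] at this
      · right; rw [h.1] at this; rwa [← abs_neg, neg_add']
    simp only [mem_union, Metric.mem_closedBall, Real.dist_eq]
    by_cases hc : θ - φ ≤ π
    · left
      rcases key (θ - φ) ⟨by linarith [h1.1, hφ.2], hc⟩ h2 with h | h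
      · left; convert h using 2; ring
      · right; convert h using 2; ring
    · right
      push Not at hc
      rcases key (θ - φ - 2 * π) ⟨by linarith, by linarith [h1.2, hφ.1]⟩
        (by rwa [Real.cos_sub_two_pi]) with h | h
      · left; convert h using 2; ring
      · right; convert h using 2; ring
  refine (measure_mono hsub).trans ?_
  refine (measure_union_le _ _).trans ?_
  refine (add_le_add (measure_union_le _ _) (measure_union_le _ _)).trans ?_
  simp only [Real.volume_closedBall]
  by_cases hr : 0 ≤ r
  · rw [← ENNReal.ofReal_add (by positivity) (by positivity),
      ← ENNReal.ofReal_add (by positivity) (by positivity)]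
    apply ENNReal.ofReal_le_ofReal; linarith
  · rw [ENNReal.ofReal_of_nonpos (by linarith : 2 * r ≤ 0)]; simp

def EE (k ε x y : ℝ) : Set ℝ :=
  {θ : ℝ | θ ∈ Ico 0 (2 * π) ∧
    |(k * Real.cos θ + x) ^ 2 + (k * Real.sin θ + y) ^ 2 - k ^ 2| ≤ 2 * ε}

lemma polar (x y : ℝ) : ∃ φ ∈ Icc (-π) π, x = √(x ^ 2 + y ^ 2) * Real.cos φ ∧
    y = √(x ^ 2 + y ^ 2) * Real.sin φ := by
  refine ⟨Complex.arg ⟨x, y⟩, ⟨(Complex.neg_pi_lt_arg _).le, Complex.arg_le_pi _⟩, ?_, ?_⟩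
  · have := Complex.norm_mul_cos_arg ⟨x, y⟩
    rw [Complex.norm_eq_sqrt_sq_add_sq] at this
    exact this.symm
  · have := Complex.norm_mul_sin_arg ⟨x, y⟩
    rw [Complex.norm_eq_sqrt_sq_add_sq] at this
    exact this.symm

lemma EE_sub (k ε x y P : ℝ) (hk : 0 < k) (hP : 0 < P) (hPs : P = √(x ^ 2 + y ^ 2)) :
    ∃ φ ∈ Icc (-π) π, EE k ε x y ⊆
      {θ : ℝ | θ ∈ Ico 0 (2 * π) ∧ |Real.cos (θ - φ) + P / (2 * k)| ≤ ε / (k * P)} := by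
  obtain ⟨φ, hφ, hx, hy⟩ := polar x y
  rw [← hPs] at hx hy
  refine ⟨φ, hφ, ?_⟩
  rintro θ ⟨h1, h2⟩
  refine ⟨h1, ?_⟩
  have e : (k * Real.cos θ + x) ^ 2 + (k * Real.sin θ + y) ^ 2 - k ^ 2 =
      (Real.cos (θ - φ) + P / (2 * k)) * (2 * k * P) := by
    rw [hx, hy, Real.cos_sub]
    field_simp
    linear_combination k ^ 2 * Real.sin_sq_add_cos_sq θ + P ^ 2 * Real.sin_sq_add_cos_sq φ
  rw [e, abs_mul, abs_of_pos (by positivity : 0 < 2 * k * P)] at h2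
  rw [le_div_iff₀ (by positivity)]
  linarith

lemma EE_volA (k ε x y P : ℝ) (hk : 0 < k) (hP : 0 < P) (hPs : P = √(x ^ 2 + y ^ 2)) :
    volume (EE k ε x y) ≤ ENNReal.ofReal (8 * (π * √(ε / (k * P)))) := by
  obtain ⟨φ, hφ, hs⟩ := EE_sub k ε x y P hk hP hPs
  obtain ⟨z, hz⟩ := arcA (P / (2 * k)) (ε / (k * P))
  exact (measure_mono hs).trans (arc_cover _ _ _ z _ hφ hz)

lemma EE_volB (k ε x y P : ℝ) (hk : 0 < k) (hP : 0 < P) (hPs : P = √(x ^ 2 + y ^ 2))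
    (h : (P / (2 * k)) ^ 2 < 1) :
    volume (EE k ε x y) ≤
      ENNReal.ofReal (8 * (π * ((ε / (k * P)) / √(1 - (P / (2 * k)) ^ 2)))) := by
  obtain ⟨φ, hφ, hs⟩ := EE_sub k ε x y P hk hP hPs
  obtain ⟨z, hz⟩ := arcB (P / (2 * k)) (ε / (k * P)) h
  exact (measure_mono hs).trans (arc_cover _ _ _ z _ hφ hz)

lemma EE_nonempty (k ε x y P : ℝ) (hk : 0 < k) (hε : 0 < ε) (hP : 0 < P)
    (hPs : P = √(x ^ 2 + y ^ 2))
    (h : (EE k ε x y).Nonempty) : P ^ 2 ≤ 4 * k ^ 2 + 4 * ε := by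
  obtain ⟨φ, hφ, hs⟩ := EE_sub k ε x y P hk hP hPs
  obtain ⟨θ, hθ⟩ := h
  have h2 := (abs_le.mp (hs hθ).2).2
  have h3 := Real.neg_one_le_cos (θ - φ)
  have h4 : P / (2 * k) - 1 ≤ ε / (k * P) := by linarith
  have h5 : P * (P - 2 * k) ≤ 2 * ε := by
    have := mul_le_mul_of_nonneg_right h4 (by positivity : 0 ≤ 2 * k * P)
    have e1 : (P / (2 * k) - 1) * (2 * k * P) = P * (P - 2 * k) := by field_simp
    have e2 : ε / (k * P) * (2 * k * P) = 2 * ε := by field_simp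
    linarith
  by_cases hc : P ≤ 2 * k
  · nlinarith
  · push Not at hc
    nlinarith
def ww (n : ℕ) : ℝ := 1 / √(max 1 (n : ℝ))

def F1 (N : ℕ) : Finset ℤ :=
  (Finset.range (N + 1)).image (fun n : ℕ => (n : ℤ)) ∪
  (Finset.range (N + 1)).image (fun n : ℕ => -(n : ℤ))

lemma mem_F1 (N : ℕ) (j : ℤ) (h : j.natAbs ≤ N) : j ∈ F1 N := by
  simp only [F1, Finset.mem_union, Finset.mem_image, Finset.mem_range]
  rcases Int.natAbs_eq j with h' | h'
  · left; exact ⟨j.natAbs, by omega, h'.symm⟩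
  · right; exact ⟨j.natAbs, by omega, h'.symm⟩

lemma sum_F1 (N : ℕ) (u : ℕ → ℝ) (hu : ∀ n, 0 ≤ u n) :
    ∑ j ∈ F1 N, u j.natAbs ≤ 2 * ∑ n ∈ Finset.range (N + 1), u n := by
  have h := Finset.sum_union_inter (s₁ := (Finset.range (N + 1)).image (fun n : ℕ => (n : ℤ)))
    (s₂ := (Finset.range (N + 1)).image (fun n : ℕ => -(n : ℤ))) (f := fun j => u j.natAbs)
  rw [Finset.sum_image (by intro a _ b _ h; simpa using h),
    Finset.sum_image (by intro a _ b _ h; simpa using h)] at h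
  simp only [Int.natAbs_neg, Int.natAbs_natCast] at h
  have h0 : 0 ≤ ∑ j ∈ (Finset.range (N + 1)).image (fun n : ℕ => (n : ℤ)) ∩
    (Finset.range (N + 1)).image (fun n : ℕ => -(n : ℤ)), u j.natAbs :=
    Finset.sum_nonneg (fun _ _ => hu _)
  unfold F1
  linarith

lemma sum_inv_sqrt (M : ℕ) : ∑ n ∈ Finset.range M, 1 / √((n : ℝ) + 1) ≤ 2 * √(M : ℝ) := by
  induction M with
  | zero => simp
  | succ n ih =>
    rw [Finset.sum_range_succ]
    push_cast
    have h1 : 0 < √((n : ℝ) + 1) := Real.sqrt_pos.mpr (by positivity)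
    have h2 : √((n : ℝ) + 1) ^ 2 = n + 1 := Real.sq_sqrt (by positivity)
    have h3 : √(n : ℝ) ^ 2 = n := Real.sq_sqrt (by positivity)
    have : 1 / √((n : ℝ) + 1) ≤ 2 * (√((n : ℝ) + 1) - √(n : ℝ)) := by
      rw [div_le_iff₀ h1]
      nlinarith [sq_nonneg (√((n : ℝ) + 1) - √(n : ℝ))]
    linarith

lemma sum_ww (N : ℕ) (hN : 1 ≤ N) : ∑ j ∈ F1 N, ww j.natAbs ≤ 6 * √(N : ℝ) := by
  refine (sum_F1 N ww (fun n => by unfold ww; positivity)).trans ?_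
  rw [Finset.sum_range_succ']
  have h : ∑ n ∈ Finset.range N, ww (n + 1) = ∑ n ∈ Finset.range N, 1 / √((n : ℝ) + 1) := by
    apply Finset.sum_congr rfl
    intro n _
    unfold ww
    rw [max_eq_right (by push_cast; linarith [(Nat.cast_nonneg n : (0:ℝ) ≤ n)])]
    push_cast; rfl
  rw [h]
  have h0 : ww 0 = 1 := by simp [ww]
  have := sum_inv_sqrt N
  have : 1 ≤ √(N : ℝ) := Real.one_le_sqrt.mpr (by exact_mod_cast hN)
  rw [h0]
  linarith

def v2 (M n : ℕ) : ℝ := if n < M then 1 / (√(M : ℝ) * √((M : ℝ) - n)) else 0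
def v3 (M n : ℕ) : ℝ := if n = M ∨ n = M + 1 then 1 else 0

lemma v2_nonneg (M n : ℕ) : 0 ≤ v2 M n := by unfold v2; split_ifs <;> positivity
lemma v3_nonneg (M n : ℕ) : 0 ≤ v3 M n := by unfold v3; split_ifs <;> norm_num

lemma sum_v2 (M N : ℕ) : ∑ j ∈ F1 N, v2 M j.natAbs ≤ 4 := by
  refine (sum_F1 N (v2 M) (v2_nonneg M)).trans ?_
  have h1 : ∑ n ∈ Finset.range (N + 1), v2 M n ≤
      ∑ n ∈ Finset.range M, 1 / (√(M : ℝ) * √((M : ℝ) - n)) := by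
    unfold v2
    rw [← Finset.sum_filter]
    apply Finset.sum_le_sum_of_subset_of_nonneg
    · intro n; simp
    · intros; positivity
  have h2 : ∑ n ∈ Finset.range M, 1 / (√(M : ℝ) * √((M : ℝ) - n)) =
      1 / √(M : ℝ) * ∑ n ∈ Finset.range M, 1 / √((n : ℝ) + 1) := by
    rw [← Finset.sum_range_reflect (fun n : ℕ => 1 / √((n : ℝ) + 1)), Finset.mul_sum]
    apply Finset.sum_congr rfl
    intro n hn
    have hn := Finset.mem_range.mp hn
    have : ((M - 1 - n : ℕ) : ℝ) + 1 = (M : ℝ) - n := by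
      have : M - 1 - n + 1 + n = M := by omega
      have : (((M - 1 - n + 1 + n : ℕ)) : ℝ) = M := by rw [this]
      push_cast at this
      linarith
    rw [this, one_div_mul_one_div]
  have h3 : 1 / √(M : ℝ) * ∑ n ∈ Finset.range M, 1 / √((n : ℝ) + 1) ≤ 2 := by
    rcases Nat.eq_zero_or_pos M with rfl | hM
    · simp
    · have : 0 < √(M : ℝ) := Real.sqrt_pos.mpr (by exact_mod_cast hM)
      rw [one_div_mul_eq_div, div_le_iff₀ this]
      exact sum_inv_sqrt M
  linarith

lemma sum_v3 (M N : ℕ) : ∑ j ∈ F1 N, v3 M j.natAbs ≤ 4 := by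
  refine (sum_F1 N (v3 M) (v3_nonneg M)).trans ?_
  have h1 : ∑ n ∈ Finset.range (N + 1), v3 M n ≤ ∑ n ∈ ({M, M + 1} : Finset ℕ), 1 := by
    unfold v3
    rw [← Finset.sum_filter]
    apply Finset.sum_le_sum_of_subset_of_nonneg
    · intro n; simp
    · intros; positivity
  have h2 : ∑ n ∈ ({M, M + 1} : Finset ℕ), (1 : ℝ) = 2 := by
    rw [Finset.sum_pair (by omega)]; norm_num
  linarith

lemma sum_one (N : ℕ) (hN : 1 ≤ N) : ∑ _j ∈ F1 N, (1 : ℝ) ≤ 4 * N := by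
  refine (sum_F1 N (fun _ => 1) (fun _ => zero_le_one)).trans ?_
  simp
  have : (1 : ℝ) ≤ N := by exact_mod_cast hN
  linarith

lemma sum_total (N : ℕ) (hN : 1 ≤ N) (A B D : ℝ) (hA : 0 ≤ A) (hB : 0 ≤ B) (hD : 0 ≤ D)
    (M : ℤ → ℕ) :
    ∑ m ∈ F1 N ×ˢ F1 N, (A * (ww m.1.natAbs * ww m.2.natAbs) + B * v2 (M m.1) m.2.natAbs
      + D * v3 (M m.1) m.2.natAbs) ≤ N * (36 * A + 16 * B + 16 * D) := by
  rw [Finset.sum_add_distrib, Finset.sum_add_distrib, ← Finset.mul_sum, ← Finset.mul_sum,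
    ← Finset.mul_sum]
  have h1 : ∑ m ∈ F1 N ×ˢ F1 N, (ww m.1.natAbs * ww m.2.natAbs) ≤ 36 * N := by
    rw [Finset.sum_product]
    simp only []
    rw [← Finset.sum_mul_sum]
    have h := sum_ww N hN
    have h0 : 0 ≤ ∑ j ∈ F1 N, ww j.natAbs :=
      Finset.sum_nonneg (fun _ _ => by unfold ww; positivity)
    have h2 : √(N : ℝ) ^ 2 = N := Real.sq_sqrt (by positivity)
    nlinarith [Real.sqrt_nonneg (N : ℝ)]
  have key : ∀ v : ℕ → ℕ → ℝ, (∀ M, ∑ j ∈ F1 N, v M j.natAbs ≤ 4) →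
      ∑ m ∈ F1 N ×ˢ F1 N, v (M m.1) m.2.natAbs ≤ 16 * N := by
    intro v hv
    rw [Finset.sum_product]
    calc _ ≤ ∑ j ∈ F1 N, (4 : ℝ) * 1 := by
          apply Finset.sum_le_sum; intro j _; simpa using hv (M j)
      _ = 4 * ∑ j ∈ F1 N, (1 : ℝ) := by rw [Finset.mul_sum]
      _ ≤ _ := by linarith [sum_one N hN]
  have h2 := key v2 (fun M => sum_v2 M N)
  have h3 := key v3 (fun M => sum_v3 M N)
  have := mul_le_mul_of_nonneg_left h1 hA
  have := mul_le_mul_of_nonneg_left h2 hB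
  have := mul_le_mul_of_nonneg_left h3 hD
  linarith
set_option maxHeartbeats 1000000 in
lemma per_m (k ε d d1 d2 : ℝ) (hk : 1 ≤ k) (hε : 0 < ε) (hd : 0 < d)
    (hεd : 2 * √ε ≤ d) (h1 : d ≤ d1) (h2 : d ≤ d2) (m : ℤ × ℤ) (hm : m ≠ 0) :
    volume (EE k ε (d1 * m.1) (d2 * m.2)) ≤ ENNReal.ofReal
      (16 * π * ε / (k * d) * (ww m.1.natAbs * ww m.2.natAbs)
        + 16 * π * ε / (k * d) * v2 ⌊√(4 * k ^ 2 - (d1 * m.1) ^ 2) / d2⌋₊ m.2.natAbs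
        + 8 * π * √ε / k * v3 ⌊√(4 * k ^ 2 - (d1 * m.1) ^ 2) / d2⌋₊ m.2.natAbs) := by
  have hd1 : 0 < d1 := hd.trans_le h1
  have hd2 : 0 < d2 := hd.trans_le h2
  have hk0 : 0 < k := by linarith
  obtain ⟨m1, m2⟩ := m
  simp only
  set x := d1 * (m1 : ℝ) with hx
  set y := d2 * (m2 : ℝ) with hy
  set R := √(4 * k ^ 2 - x ^ 2) with hR
  set M := ⌊R / d2⌋₊ with hM
  set n1 := m1.natAbs with hn1
  set n2 := m2.natAbs with hn2
  have hR0 : 0 ≤ R := Real.sqrt_nonneg _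
  have e1 : (n1 : ℝ) = |(m1 : ℝ)| := by rw [hn1, Nat.cast_natAbs, Int.cast_abs]
  have e2 : (n2 : ℝ) = |(m2 : ℝ)| := by rw [hn2, Nat.cast_natAbs, Int.cast_abs]
  have hx' : |x| = d1 * n1 := by rw [hx, abs_mul, abs_of_pos hd1, e1]
  have hy' : |y| = d2 * n2 := by rw [hy, abs_mul, abs_of_pos hd2, e2]
  have hmax1 : 1 ≤ max n1 n2 := by
    by_contra h
    have h0 : n1 = 0 ∧ n2 = 0 := by omega
    apply hm
    ext
    · simpa using Int.natAbs_eq_zero.mp h0.1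
    · simpa using Int.natAbs_eq_zero.mp h0.2
  have hmaxR : (1 : ℝ) ≤ max (n1 : ℝ) n2 := by exact_mod_cast hmax1
  set P := √(x ^ 2 + y ^ 2) with hP
  have hP2 : P ^ 2 = x ^ 2 + y ^ 2 := Real.sq_sqrt (by positivity)
  have hPx : |x| ≤ P := Real.abs_le_sqrt (by nlinarith [sq_nonneg y])
  have hPy : |y| ≤ P := Real.abs_le_sqrt (by nlinarith [sq_nonneg x])
  have hPmax : d * max (n1 : ℝ) n2 ≤ P := by
    rcases max_choice (n1 : ℝ) n2 with h | h <;> rw [h]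
    · exact le_trans (by rw [hx']; gcongr) hPx
    · exact le_trans (by rw [hy']; gcongr) hPy
  have hP0 : 0 < P := by nlinarith
  have hA : 0 ≤ 16 * π * ε / (k * d) := by positivity
  have hD : 0 ≤ 8 * π * √ε / k := by positivity
  have hww : 0 ≤ ww n1 * ww n2 := by unfold ww; positivity
  have hv2 := v2_nonneg M n2
  have hv3 := v3_nonneg M n2
  have hww' : 1 / max (n1 : ℝ) n2 ≤ ww n1 * ww n2 := by
    unfold ww
    rw [one_div_mul_one_div, ← Real.sqrt_mul (by positivity)]
    have h01 : (0 : ℝ) < max 1 (n1 : ℝ) := by positivity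
    have h02 : (0 : ℝ) < max 1 (n2 : ℝ) := by positivity
    apply one_div_le_one_div_of_le (Real.sqrt_pos.mpr (by positivity))
    rw [Real.sqrt_le_left (by positivity), sq]
    apply mul_le_mul _ _ h02.le (by positivity)
    · exact max_le hmaxR (le_max_left _ _)
    · exact max_le hmaxR (le_max_right _ _)
  by_cases hne : (EE k ε x y).Nonempty
  swap
  · rw [Set.not_nonempty_iff_eq_empty.mp hne]; simp
  have hPk := EE_nonempty k ε x y P hk0 hε hP0 hP hne
  by_cases hc : P ^ 2 ≤ 2 * k ^ 2
  · have hq : (P / (2 * k)) ^ 2 ≤ 1 / 2 := by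
      rw [div_pow, div_le_iff₀ (by positivity)]; nlinarith
    refine (EE_volB k ε x y P hk0 hP0 hP (by linarith)).trans (ENNReal.ofReal_le_ofReal ?_)
    have hs : 1 / 2 ≤ √(1 - (P / (2 * k)) ^ 2) := Real.le_sqrt_of_sq_le (by linarith)
    have hb : 8 * (π * ((ε / (k * P)) / √(1 - (P / (2 * k)) ^ 2))) ≤
        16 * π * ε / (k * d) * (ww n1 * ww n2) := by
      calc 8 * (π * ((ε / (k * P)) / √(1 - (P / (2 * k)) ^ 2)))
          ≤ 8 * (π * ((ε / (k * (d * max (n1 : ℝ) n2))) / (1 / 2))) := by gcongr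
        _ = 16 * π * ε / (k * d) * (1 / max (n1 : ℝ) n2) := by field_simp; ring
        _ ≤ _ := by gcongr
    have := mul_nonneg hA hv2
    have := mul_nonneg hD hv3
    linarith
  push Not at hc
  have hPgek : k ≤ P := by
    by_contra h
    push Not at h
    nlinarith
  by_cases hlt : n2 < M
  · have hMpos : 0 < M := by omega
    have hMR : (M : ℝ) * d2 ≤ R := by
      have := Nat.floor_le (div_nonneg hR0 hd2.le)
      rw [le_div_iff₀ hd2] at this
      exact this
    have hMr : (0 : ℝ) < M := by exact_mod_cast hMpos
    have hMn : (0 : ℝ) < (M : ℝ) - n2 := by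
      have : (n2 : ℝ) < M := by exact_mod_cast hlt
      linarith
    have hRpos : 0 < R := lt_of_lt_of_le (by positivity) hMR
    have hR2 : R ^ 2 = 4 * k ^ 2 - x ^ 2 := Real.sq_sqrt (Real.sqrt_pos.mp hRpos).le
    have hlow : (d * (√(M : ℝ) * √((M : ℝ) - n2))) ^ 2 ≤ 4 * k ^ 2 - P ^ 2 := by
      rw [mul_pow, mul_pow, Real.sq_sqrt hMr.le, Real.sq_sqrt hMn.le, hP2]
      have hy2 : y ^ 2 = (d2 * n2) ^ 2 := by rw [← hy', sq_abs]
      have e : 4 * k ^ 2 - (x ^ 2 + y ^ 2) = R ^ 2 - (d2 * n2) ^ 2 := by rw [hR2, hy2]; ring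
      rw [e]
      calc d ^ 2 * ((M : ℝ) * ((M : ℝ) - n2)) ≤ d2 ^ 2 * ((M : ℝ) * ((M : ℝ) - n2)) := by gcongr
        _ ≤ d2 ^ 2 * (((M : ℝ) + n2) * ((M : ℝ) - n2)) := by gcongr; simp
        _ = (M * d2) ^ 2 - (d2 * n2) ^ 2 := by ring
        _ ≤ _ := by gcongr
    set S := √(M : ℝ) * √((M : ℝ) - n2) with hS
    have hS0 : 0 < S := mul_pos (Real.sqrt_pos.mpr hMr) (Real.sqrt_pos.mpr hMn)
    have hsq : (d * S / (2 * k)) ^ 2 ≤ 1 - (P / (2 * k)) ^ 2 := by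
      rw [div_pow, div_pow, le_sub_iff_add_le, ← add_div, div_le_one (by positivity)]
      linarith
    have hpos : 0 < (d * S / (2 * k)) ^ 2 := by positivity
    refine (EE_volB k ε x y P hk0 hP0 hP (by linarith)).trans (ENNReal.ofReal_le_ofReal ?_)
    have hs : d * S / (2 * k) ≤ √(1 - (P / (2 * k)) ^ 2) := Real.le_sqrt_of_sq_le hsq
    have hv : v2 M n2 = 1 / S := by unfold v2; rw [if_pos hlt]
    have hb : 8 * (π * ((ε / (k * P)) / √(1 - (P / (2 * k)) ^ 2))) ≤
        16 * π * ε / (k * d) * v2 M n2 := by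
      calc 8 * (π * ((ε / (k * P)) / √(1 - (P / (2 * k)) ^ 2)))
          ≤ 8 * (π * ((ε / (k * k)) / (d * S / (2 * k)))) := by gcongr
        _ = 16 * π * ε / (k * d) * (1 / S) := by field_simp; ring
        _ = _ := by rw [hv]
    have := mul_nonneg hA hww
    have := mul_nonneg hD hv3
    linarith
  · push Not at hlt
    have hyR : |y| ≤ R + d2 := by
      have h3 : y ^ 2 ≤ R ^ 2 + (2 * √ε) ^ 2 := by
        have e4 : (2 * √ε) ^ 2 = 4 * ε := by rw [mul_pow, Real.sq_sqrt hε.le]; norm_num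
        rw [e4]
        have : 4 * k ^ 2 - x ^ 2 ≤ R ^ 2 := by
          by_cases h : 0 ≤ 4 * k ^ 2 - x ^ 2
          · rw [hR, Real.sq_sqrt h]
          · push Not at h; exact h.le.trans (sq_nonneg _)
        linarith
      apply abs_le_of_sq_le_sq _ (by positivity)
      have : 0 ≤ √ε := Real.sqrt_nonneg _
      have : (2 * √ε) ^ 2 ≤ d2 ^ 2 := by gcongr; linarith
      have := mul_nonneg hR0 hd2.le
      linarith [add_sq R d2]
    have hn : n2 = M ∨ n2 = M + 1 := by
      have h3 : (n2 : ℝ) ≤ R / d2 + 1 := by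
        rw [hy'] at hyR
        rw [div_add_one hd2.ne', le_div_iff₀ hd2]; linarith
      have h4 := Nat.lt_floor_add_one (R / d2)
      rw [← hM] at h4
      have h5 : (n2 : ℝ) < M + 1 + 1 := by linarith
      have h6 : n2 < M + 1 + 1 := by exact_mod_cast h5
      omega
    have hv : v3 M n2 = 1 := by unfold v3; rw [if_pos hn]
    refine (EE_volA k ε x y P hk0 hP0 hP).trans (ENNReal.ofReal_le_ofReal ?_)
    have hb : 8 * (π * √(ε / (k * P))) ≤ 8 * π * √ε / k * v3 M n2 := by
      calc 8 * (π * √(ε / (k * P))) ≤ 8 * (π * √(ε / (k * k))) := by gcongr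
        _ = 8 * π * √ε / k * v3 M n2 := by
          rw [hv, Real.sqrt_div hε.le, Real.sqrt_mul_self hk0.le]; ring
    have := mul_nonneg hA hww
    have := mul_nonneg hA hv2
    linarith

lemma total (k ε d d1 d2 : ℝ) (hk : 1 ≤ k) (hε : 0 < ε) (hε1 : ε ≤ 1) (hd : 0 < d)
    (hεd : 2 * √ε ≤ d) (hdk : d ≤ k) (h1 : d ≤ d1) (h2 : d ≤ d2) :
    volume (⋃ m ∈ {m : ℤ × ℤ | m ≠ 0}, EE k ε (d1 * m.1) (d2 * m.2)) ≤
      ENNReal.ofReal (2496 * π * (ε / d ^ 2) + 384 * π * (√ε / d)) := by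
  have hd1 : 0 < d1 := hd.trans_le h1
  have hd2 : 0 < d2 := hd.trans_le h2
  have hk0 : 0 < k := by linarith
  set N := ⌊3 * k / d⌋₊ with hN
  have hNle : (N : ℝ) ≤ 3 * k / d := Nat.floor_le (by positivity)
  have hN1 : 1 ≤ N := by
    rw [hN, Nat.one_le_floor_iff, le_div_iff₀ hd]; linarith
  have hsub : (⋃ m ∈ {m : ℤ × ℤ | m ≠ 0}, EE k ε (d1 * m.1) (d2 * m.2)) ⊆
      ⋃ m ∈ (F1 N ×ˢ F1 N).filter (fun m => m ≠ 0), EE k ε (d1 * m.1) (d2 * m.2) := by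
    intro θ hθ
    simp only [mem_iUnion, mem_ofPred_eq] at hθ
    obtain ⟨m, hm, hθ⟩ := hθ
    simp only [mem_iUnion]
    refine ⟨m, ?_, hθ⟩
    rw [Finset.mem_filter, Finset.mem_product]
    have hpos : 0 < (d1 * (m.1 : ℝ)) ^ 2 + (d2 * (m.2 : ℝ)) ^ 2 := by
      by_cases h : m.1 = 0
      · have : m.2 ≠ 0 := fun h' => hm (by ext <;> simp [h, h'])
        have : (m.2 : ℝ) ≠ 0 := by exact_mod_cast this
        positivity
      · have : (m.1 : ℝ) ≠ 0 := by exact_mod_cast h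
        positivity
    have hP := EE_nonempty k ε _ _ _ hk0 hε (Real.sqrt_pos.mpr hpos) rfl ⟨θ, hθ⟩
    rw [Real.sq_sqrt hpos.le] at hP
    have key : ∀ (e : ℝ) (j : ℤ), d ≤ e → (e * (j : ℝ)) ^ 2 ≤ 4 * k ^ 2 + 4 * ε → j ∈ F1 N := by
      intro e j he hj
      apply mem_F1
      have he0 : 0 < e := hd.trans_le he
      rw [hN]
      apply Nat.le_floor
      rw [Nat.cast_natAbs, Int.cast_abs, le_div_iff₀ hd]
      have h3 : |e * (j : ℝ)| ≤ 3 * k := abs_le_of_sq_le_sq (by nlinarith) (by positivity)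
      rw [abs_mul, abs_of_pos he0] at h3
      have := abs_nonneg (j : ℝ)
      nlinarith
    exact ⟨⟨key d1 m.1 h1 (by nlinarith [sq_nonneg (d2 * (m.2 : ℝ))]),
      key d2 m.2 h2 (by nlinarith [sq_nonneg (d1 * (m.1 : ℝ))])⟩, hm⟩
  refine (measure_mono hsub).trans ((measure_biUnion_finset_le _ _).trans ?_)
  have hA : 0 ≤ 16 * π * ε / (k * d) := by positivity
  have hD : 0 ≤ 8 * π * √ε / k := by positivity
  have hnn : ∀ m : ℤ × ℤ, 0 ≤ (16 * π * ε / (k * d) * (ww m.1.natAbs * ww m.2.natAbs)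
        + 16 * π * ε / (k * d) * v2 ⌊√(4 * k ^ 2 - (d1 * m.1) ^ 2) / d2⌋₊ m.2.natAbs
        + 8 * π * √ε / k * v3 ⌊√(4 * k ^ 2 - (d1 * m.1) ^ 2) / d2⌋₊ m.2.natAbs) := by
    intro m
    have hww : 0 ≤ ww m.1.natAbs * ww m.2.natAbs := by unfold ww; positivity
    have := mul_nonneg hA hww
    have := mul_nonneg hA (v2_nonneg ⌊√(4 * k ^ 2 - (d1 * m.1) ^ 2) / d2⌋₊ m.2.natAbs)
    have := mul_nonneg hD (v3_nonneg ⌊√(4 * k ^ 2 - (d1 * m.1) ^ 2) / d2⌋₊ m.2.natAbs)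
    linarith
  refine (Finset.sum_le_sum (fun m hm => per_m k ε d d1 d2 hk hε hd hεd h1 h2 m
    (Finset.mem_filter.mp hm).2)).trans ?_
  rw [← ENNReal.ofReal_sum_of_nonneg (fun m _ => hnn m)]
  apply ENNReal.ofReal_le_ofReal
  refine (Finset.sum_le_sum_of_subset_of_nonneg (Finset.filter_subset _ _)
    (fun m _ _ => hnn m)).trans ?_
  refine (sum_total N hN1 _ _ _ hA hA hD
    (fun j => ⌊√(4 * k ^ 2 - (d1 * j) ^ 2) / d2⌋₊)).trans ?_
  calc _ ≤ (3 * k / d) * (36 * (16 * π * ε / (k * d)) + 16 * (16 * π * ε / (k * d))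
        + 16 * (8 * π * √ε / k)) := by gcongr
    _ = _ := by field_simp; ring
lemma circ_dist (k : ℝ) (hk : 0 < k) (a b : ℝ) :
    dist (circpt k a) (circpt k b) = 2 * k * |Real.sin ((a - b) / 2)| := by
  rw [EuclideanSpace.dist_eq]
  simp only [circpt, Fin.sum_univ_two, Real.dist_eq, sq_abs]
  simp
  rw [show 2 * k * |Real.sin ((a - b) / 2)| = |2 * k * Real.sin ((a - b) / 2)| by
    rw [abs_mul, abs_of_pos (by positivity : 0 < 2 * k)], ← Real.sqrt_sq_eq_abs]
  congr 1
  have h := Real.cos_sq ((a - b) / 2)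
  rw [show 2 * ((a - b) / 2) = a - b by ring] at h
  have h' := Real.sin_sq_add_cos_sq ((a - b) / 2)
  have h2 := Real.cos_sub a b
  have h3 := Real.sin_sq_add_cos_sq a
  have h4 := Real.sin_sq_add_cos_sq b
  have h5 : Real.sin ((a - b) / 2) ^ 2 = 1 / 2 - Real.cos (a - b) / 2 := by linarith
  rw [mul_pow, h5, h2]
  linear_combination k ^ 2 * h3 + k ^ 2 * h4

lemma circ_cont (k : ℝ) : Continuous (circpt k) := by
  unfold circpt
  simp only [WithLp.equiv_symm_apply]
  apply (PiLp.continuous_toLp 2 (fun _ : Fin 2 => ℝ)).comp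
  apply continuous_pi
  intro i
  fin_cases i <;> simp <;> fun_prop

lemma circ_inj (k : ℝ) (hk : 0 < k) : InjOn (circpt k) (Ico 0 (2 * π)) := by
  intro a ha b hb h
  have h1 := circ_dist k hk a b
  rw [h, dist_self] at h1
  have h2 : Real.sin ((a - b) / 2) = 0 := by
    have : |Real.sin ((a - b) / 2)| = 0 := by
      rcases mul_eq_zero.mp h1.symm with h | h
      · linarith
      · exact h
    exact abs_eq_zero.mp this
  have := (Real.sin_eq_zero_iff_of_lt_of_lt (by linarith [ha.1, hb.2]) (by linarith [ha.2, hb.1])).mp h2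
  linarith

lemma circ_low (k c ρ : ℝ) (hk : 0 < k) (hρ : ρ ≤ 1) (hρc : ρ ^ 2 ≤ 1 - c)
    (a b : ℝ) (hab : |a - b| ≤ ρ) : c * k * |a - b| ≤ dist (circpt k a) (circpt k b) := by
  rw [circ_dist k hk]
  rcases (abs_nonneg (a - b)).eq_or_lt with h | h
  · rw [← h]; simp; positivity
  · have h1 : |(a - b) / 2| = |a - b| / 2 := by rw [abs_div]; norm_num
    have h3 : Real.sin |(a - b) / 2| ≤ |Real.sin ((a - b)/2)| := by
      rcases abs_cases ((a - b)/2) with h | h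
      · rw [h.1]; exact le_abs_self _
      · rw [h.1, Real.sin_neg]; exact neg_le_abs _
    rw [h1] at h3
    have h2 := Real.sin_gt_sub_cube (x := |a - b| / 2) (by positivity)
    have h4 : c * |a - b| ≤ 2 * |Real.sin ((a - b)/2)| := by
      have : |a - b| ^ 2 ≤ 1 - c := le_trans (by gcongr) hρc
      nlinarith [mul_le_mul_of_nonneg_left this h.le, pow_pos h 3]
    nlinarith

lemma piece (k c ρ : ℝ) (hk : 0 < k) (hc : 0 < c) (hρ : ρ ≤ 1) (hρc : ρ ^ 2 ≤ 1 - c)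
    (T : Set ℝ) (hT : ∀ a ∈ T, ∀ b ∈ T, |a - b| ≤ ρ) :
    ENNReal.ofReal (c * k) * volume T ≤ μH[1] (circpt k '' T) := by
  have hck : 0 < c * k := by positivity
  have hlow : ∀ a ∈ T, ∀ b ∈ T, c * k * |a - b| ≤ dist (circpt k a) (circpt k b) :=
    fun a ha b hb => circ_low k c ρ hk hρ hρc a b (hT a ha b hb)
  have hinj : InjOn (circpt k) T := by
    intro a ha b hb h
    have h1 := hlow a ha b hb
    rw [h, dist_self] at h1
    have : |a - b| ≤ 0 := by
      by_contra h'
      push Not at h'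
      nlinarith [mul_pos hck h']
    have := abs_eq_zero.mp (le_antisymm this (abs_nonneg _))
    linarith
  have hL : LipschitzOnWith (Real.toNNReal (c * k)⁻¹) (Function.invFunOn (circpt k) T)
      (circpt k '' T) := by
    apply LipschitzOnWith.of_dist_le_mul
    rintro _ ⟨a, ha, rfl⟩ _ ⟨b, hb, rfl⟩
    rw [hinj.leftInvOn_invFunOn ha, hinj.leftInvOn_invFunOn hb, Real.dist_eq,
      Real.coe_toNNReal _ (by positivity), inv_mul_eq_div, le_div_iff₀ hck]
    linarith [hlow a ha b hb]
  have h := hL.hausdorffMeasure_image_le (d := 1) zero_le_one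
  rw [hinj.leftInvOn_invFunOn.image_image, hausdorffMeasure_real, ENNReal.rpow_one] at h
  calc ENNReal.ofReal (c * k) * volume T
      ≤ ENNReal.ofReal (c * k) * (ENNReal.ofReal (c * k)⁻¹ * μH[1] (circpt k '' T)) := by
        gcongr; exact h
    _ = μH[1] (circpt k '' T) := by
      rw [← mul_assoc, ← ENNReal.ofReal_mul hck.le, mul_inv_cancel₀ hck.ne']; simp

lemma haus_c (k c : ℝ) (hk : 0 < k) (hc : 0 < c) (hc1 : c < 1) (S : Set ℝ)
    (hS : MeasurableSet S) (hS2 : S ⊆ Ico 0 (2 * π)) :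
    ENNReal.ofReal (c * k) * volume S ≤ μH[1] (circpt k '' S) := by
  set ρ := 1 - c with hρ
  have hρ0 : 0 < ρ := by linarith
  have hun : S = ⋃ n : ℤ, S ∩ Ico (n • ρ) ((n + 1) • ρ) := by
    rw [← inter_iUnion, iUnion_Ico_zsmul hρ0, inter_univ]
  have hdis : Pairwise (Function.onFun Disjoint fun n : ℤ => S ∩ Ico (n • ρ) ((n + 1) • ρ)) :=
    fun i j hij => (pairwise_disjoint_Ico_zsmul ρ hij).mono inter_subset_right inter_subset_right
  have hms : ∀ n : ℤ, MeasurableSet (S ∩ Ico (n • ρ) ((n + 1) • ρ)) :=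
    fun n => hS.inter measurableSet_Ico
  have himg : circpt k '' S = ⋃ n : ℤ, circpt k '' (S ∩ Ico (n • ρ) ((n + 1) • ρ)) := by
    conv_lhs => rw [hun, image_iUnion]
  have hinj := (circ_inj k hk).mono hS2
  rw [himg, measure_iUnion]
  · conv_lhs => rw [hun, measure_iUnion hdis hms, ← ENNReal.tsum_mul_left]
    apply ENNReal.tsum_le_tsum
    intro n
    apply piece k c ρ hk hc (by linarith) (by nlinarith)
    intro a ha b hb
    have h1 := ha.2
    have h2 := hb.2
    rw [add_smul, one_smul] at h1 h2
    rw [abs_le]; constructor <;> linarith [h1.1, h1.2, h2.1, h2.2]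
  · intro i j hij
    refine Set.disjoint_left.mpr ?_
    rintro _ ⟨a, ha, rfl⟩ ⟨b, hb, hab⟩
    rw [hinj hb.1 ha.1 hab] at hb
    exact Set.disjoint_left.mp (hdis hij) ha hb
  · intro n
    exact (hms n).image_of_continuousOn_injOn (circ_cont k).continuousOn
      (hinj.mono inter_subset_left)

lemma haus (k v : ℝ) (hk : 0 < k) (S : Set ℝ)
    (hS : MeasurableSet S) (hS2 : S ⊆ Ico 0 (2 * π)) (hv : ENNReal.ofReal v ≤ volume S) :
    ENNReal.ofReal (k * v) ≤ μH[1] (circpt k '' S) := by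
  have hc : ∀ c ∈ Ioo (0:ℝ) 1, ENNReal.ofReal (c * (k * v)) ≤ μH[1] (circpt k '' S) := by
    intro c hc
    refine le_trans ?_ (haus_c k c hk hc.1 hc.2 S hS hS2)
    rw [← mul_assoc, ENNReal.ofReal_mul (mul_nonneg hc.1.le hk.le)]
    gcongr
  have ht : Filter.Tendsto (fun c : ℝ => ENNReal.ofReal (c * (k * v))) (nhdsWithin 1 (Iio 1))
      (nhds (ENNReal.ofReal (k * v))) := by
    have : Continuous (fun c : ℝ => ENNReal.ofReal (c * (k * v))) :=
      ENNReal.continuous_ofReal.comp (by fun_prop)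
    have h := this.tendsto 1
    rw [one_mul] at h
    exact h.mono_left nhdsWithin_le_nhds
  refine le_of_tendsto ht ?_
  filter_upwards [Ioo_mem_nhdsLT (zero_lt_one' ℝ)] with c h using hc c h

/-- Geometric Lemma 2.1, parts 1 and 3: the first nonresonance set has asymptotically
full measure. -/
theorem statement4 (l : ℕ) (hl : 6 ≤ l) (δ b₁ b₂ : ℝ) (hb₁ : 0 < b₁) (hb₂ : 0 < b₂)
    (hδ : 0 < δ) (hδ' : 2 * δ < 2 * (l : ℝ) - 2 - 4 * s1 l) :
    ∃ C : ℝ, 0 < C ∧ ∃ k₀ : ℝ, 0 < k₀ ∧ ∀ k : ℝ, k₀ < k → 1 < k →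
      ∀ a₁ a₂ : ℝ,
        k ^ s1 l * b₁ / 4 ≤ a₁ → a₁ ≤ k ^ s1 l * b₁ →
        k ^ s1 l * b₂ / 4 ≤ a₂ → a₂ ≤ k ^ s1 l * b₂ →
        volume {θ : ℝ | θ ∈ Ico 0 (2 * π) ∧ ∃ m : ℤ × ℤ, m ≠ 0 ∧
            |‖circpt k θ + pvecE a₁ a₂ m‖ ^ 2 - k ^ 2| ≤ 2 * k ^ (-4 * s1 l - δ)}
          ≤ ENNReal.ofReal (C * k ^ (-δ / 2)) ∧
        ENNReal.ofReal (2 * π * k * (1 - C * k ^ (-δ / 2)))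
          ≤ μH[1] {x : EuclideanSpace ℝ (Fin 2) | ‖x‖ = k ∧ ∀ m : ℤ × ℤ, m ≠ 0 →
              2 * k ^ (-4 * s1 l - δ) < |‖x + pvecE a₁ a₂ m‖ ^ 2 - k ^ 2|} := by
  have hs : 0 < s1 l := by
    have : (6 : ℝ) ≤ l := by exact_mod_cast hl
    unfold s1; linarith
  set s := s1 l with hs_def
  set β := max b₁ b₂ with hβ
  have hβ0 : 0 < β := lt_max_of_lt_left hb₁
  set c0 := 2 * π / β with hc0
  have hc0p : 0 < c0 := by positivity
  set C := 2496 * π / c0 ^ 2 + 384 * π / c0 with hC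
  have hCp : 0 < C := by positivity
  refine ⟨C, hCp, (2 / c0) ^ (2 / δ) + c0, by positivity, ?_⟩
  intro k hk hk1 a₁ a₂ h1 h1' h2 h2'
  have hk0 : 0 < k := by linarith
  have hpw : 0 < (2 / c0) ^ (2 / δ) := by positivity
  have hks : 0 < k ^ s := by positivity
  have ha1 : 0 < a₁ := lt_of_lt_of_le (by positivity) h1
  have ha2 : 0 < a₂ := lt_of_lt_of_le (by positivity) h2
  set ε := k ^ (-4 * s - δ) with hε
  have hε0 : 0 < ε := by positivity
  have hε1 : ε ≤ 1 := Real.rpow_le_one_of_one_le_of_nonpos hk1.le (by linarith)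
  set d := c0 * k ^ (-s) with hd
  have hd0 : 0 < d := by positivity
  have hsε : √ε = k ^ (-2 * s - δ / 2) := by
    rw [hε, Real.sqrt_eq_rpow, ← Real.rpow_mul hk0.le]; congr 1; ring
  have hkδ : 2 * k ^ (-δ / 2) ≤ c0 := by
    have h3 : 2 / c0 ≤ k ^ (δ / 2) := by
      calc 2 / c0 = ((2 / c0) ^ (2 / δ)) ^ (δ / 2) := by
            rw [← Real.rpow_mul (by positivity)]
            rw [show 2 / δ * (δ / 2) = 1 by field_simp, Real.rpow_one]
        _ ≤ k ^ (δ / 2) := by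
          apply Real.rpow_le_rpow hpw.le _ (by positivity)
          linarith
    rw [div_le_iff₀ hc0p] at h3
    rw [show -δ / 2 = -(δ / 2) by ring, Real.rpow_neg hk0.le, ← div_eq_mul_inv,
      div_le_iff₀ (by positivity)]
    linarith
  have hεd : 2 * √ε ≤ d := by
    rw [hsε, hd]
    calc 2 * k ^ (-2 * s - δ / 2) ≤ 2 * k ^ (-δ / 2 + -s) := by
          gcongr
          · exact hk1.le
          · linarith
      _ = 2 * k ^ (-δ / 2) * k ^ (-s) := by rw [Real.rpow_add hk0]; ring
      _ ≤ _ := by gcongr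
  have hdk : d ≤ k := by
    have : k ^ (-s) ≤ 1 := Real.rpow_le_one_of_one_le_of_nonpos hk1.le (by linarith)
    nlinarith
  have hdi : ∀ a b : ℝ, 0 < a → b ≤ β → a ≤ k ^ s * b → d ≤ 2 * π / a := by
    intro a b ha hb hab
    rw [hd, hc0, Real.rpow_neg hk0.le, div_mul_eq_mul_div, ← div_eq_mul_inv, div_div]
    apply div_le_div_of_nonneg_left (by positivity) ha
    exact hab.trans (by gcongr)
  have htot := total k ε d (2 * π / a₁) (2 * π / a₂) hk1.le hε0 hε1 hd0 hεd hdk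
    (hdi a₁ b₁ ha1 (le_max_left _ _) h1') (hdi a₂ b₂ ha2 (le_max_right _ _) h2')
  have hCb : 2496 * π * (ε / d ^ 2) + 384 * π * (√ε / d) ≤ C * k ^ (-δ / 2) := by
    have e1 : ε / d ^ 2 ≤ k ^ (-δ / 2) / c0 ^ 2 := by
      rw [hd, mul_pow, ← Real.rpow_natCast (k ^ (-s)) 2, ← Real.rpow_mul hk0.le,
        mul_comm, ← div_div, hε, ← Real.rpow_sub hk0]
      gcongr
      · exact hk1.le
      · push_cast; linarith
    have e2 : √ε / d ≤ k ^ (-δ / 2) / c0 := by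
      rw [hd, mul_comm, ← div_div, hsε, ← Real.rpow_sub hk0]
      gcongr
      · exact hk1.le
      · linarith
    calc _ ≤ 2496 * π * (k ^ (-δ / 2) / c0 ^ 2) + 384 * π * (k ^ (-δ / 2) / c0) := by gcongr
      _ = _ := by rw [hC]; ring
  have hnorm : ∀ θ : ℝ, ∀ m : ℤ × ℤ, ‖circpt k θ + pvecE a₁ a₂ m‖ ^ 2 =
      (k * Real.cos θ + 2 * π / a₁ * m.1) ^ 2 + (k * Real.sin θ + 2 * π / a₂ * m.2) ^ 2 := by
    intro θ m
    rw [EuclideanSpace.norm_sq_eq]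
    simp only [circpt, pvecE, Fin.sum_univ_two, Real.norm_eq_abs, sq_abs]
    simp
    ring
  set Θ := {θ : ℝ | θ ∈ Ico 0 (2 * π) ∧ ∃ m : ℤ × ℤ, m ≠ 0 ∧
            |‖circpt k θ + pvecE a₁ a₂ m‖ ^ 2 - k ^ 2| ≤ 2 * ε} with hΘ
  have hΘeq : Θ = ⋃ m ∈ {m : ℤ × ℤ | m ≠ 0}, EE k ε (2 * π / a₁ * m.1) (2 * π / a₂ * m.2) := by
    ext θ
    simp only [hΘ, EE, mem_iUnion, mem_ofPred_eq, hnorm]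
    constructor
    · rintro ⟨h, m, hm, h'⟩; exact ⟨m, hm, h, h'⟩
    · rintro ⟨m, hm, h, h'⟩; exact ⟨h, m, hm, h'⟩
  have hΘvol : volume Θ ≤ ENNReal.ofReal (C * k ^ (-δ / 2)) := by
    rw [hΘeq]; exact htot.trans (ENNReal.ofReal_le_ofReal hCb)
  have hΘm : MeasurableSet Θ := by
    rw [hΘeq]
    apply MeasurableSet.biUnion (Set.to_countable _)
    intro m _
    apply MeasurableSet.inter measurableSet_Ico
    have hcont : Continuous (fun θ : ℝ => |(k * Real.cos θ + 2 * π / a₁ * m.1) ^ 2 +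
        (k * Real.sin θ + 2 * π / a₂ * m.2) ^ 2 - k ^ 2|) := by fun_prop
    exact (isClosed_le hcont continuous_const).measurableSet
  refine ⟨hΘvol, ?_⟩
  have hCk : 0 ≤ C * k ^ (-δ / 2) := by positivity
  have hv : ENNReal.ofReal (2 * π - C * k ^ (-δ / 2)) ≤ volume (Ico 0 (2 * π) \ Θ) := by
    refine le_trans ?_ (le_measure_sdiff)
    rw [Real.volume_Ico, sub_zero, ENNReal.ofReal_sub _ hCk]
    gcongr
  have hH := haus k _ hk0 _ (measurableSet_Ico.diff hΘm) sdiff_subset hv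
  refine le_trans ?_ (hH.trans (measure_mono ?_))
  · apply ENNReal.ofReal_le_ofReal
    have := mul_nonneg hk0.le hCk
    nlinarith [Real.pi_gt_three]
  · rintro _ ⟨θ, ⟨hθ, hθ'⟩, rfl⟩
    refine ⟨?_, ?_⟩
    · rw [EuclideanSpace.norm_eq]
      simp only [circpt, Fin.sum_univ_two, Real.norm_eq_abs, sq_abs]
      simp
      rw [Real.sqrt_eq_iff_mul_self_eq_of_pos hk0]
      linear_combination -k ^ 2 * Real.sin_sq_add_cos_sq θ
    · intro m hm
      by_contra h
      push Not at h
      exact hθ' ⟨hθ, m, hm, h⟩
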